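/- Let μ be a dyadic measure of depth m with product coefficients a(p). Then the dyadic product formula representation holds: for every binary string p = (p_1, …, p_i) of length i ≤ m, μ(p) = μ(empty string) · 2^{−i} · ∏_{j=1}^{i} (1 + ε_j · a(p_1, …, p_{j−1})), where ε_j = +1 if p_j = 0 and ε_j = −1 if p_j = 1, and (p_1, …, p_{j−1}) denotes the length-(j−1) prefix of p (the empty string when j = 1). -/

import Mathlib

/-- A dyadic measure of depth `m`. -/
structure DyadicMeasure (m : ℕ) where
  toFun : List Bool → ℝ
  nonneg : ∀ p : List Bool, p.length ≤ m → 0 ≤ toFun p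
  additive : ∀ p : List Bool, p.length < m →
    toFun p = toFun (p ++ [false]) + toFun (p ++ [true])

/-- The product coefficient of a binary string `p`. -/
noncomputable def prodCoeff {m : ℕ} (μ : DyadicMeasure m) (p : List Bool) : ℝ :=
  if μ.toFun p = 0 then 0
  else (μ.toFun (p ++ [false]) - μ.toFun (p ++ [true])) / μ.toFun p

theorem step_aux {m : ℕ} (μ : DyadicMeasure m) (q : List Bool) (b : Bool) (hq : q.length < m) :
    μ.toFun (q ++ [b]) = μ.toFun q * (1 / 2 : ℝ) *
      (1 + (if b = false then (1 : ℝ) else -1) * prodCoeff μ q) := by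
  have h := μ.additive q hq
  have h0 := μ.nonneg (q ++ [false]) (by simp; omega)
  have h1 := μ.nonneg (q ++ [true]) (by simp; omega)
  unfold prodCoeff
  by_cases hz : μ.toFun q = 0
  · cases b <;> simp [hz] <;> linarith
  · cases b <;> simp only [hz, if_true, if_false, reduceCtorEq] <;> field_simp <;> linarith

/-- The dyadic product formula representation: for every binary string `p` of length
`i ≤ m`, `μ(p) = μ(∅) · 2^{-i} · ∏_{j=1}^{i} (1 + ε_j · a(p₁,…,p_{j−1}))`, where
`ε_j = +1` if the `j`-th bit of `p` is `0` and `ε_j = −1` if it is `1`, and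
`(p₁,…,p_{j−1})` is the length-`(j−1)` prefix of `p`. -/
theorem stmt_5 {m : ℕ} (μ : DyadicMeasure m) (p : List Bool) (hp : p.length ≤ m) :
    μ.toFun p = μ.toFun [] * (1 / 2 : ℝ) ^ p.length *
      ∏ j ∈ Finset.range p.length,
        (1 + (if p.getD j false = false then (1 : ℝ) else -1) * prodCoeff μ (p.take j)) := by
  induction p using List.reverseRecOn with
  | nil => simp
  | append_singleton q b ih =>
    have hq : q.length < m := by simp at hp; omega
    have hprod : ∏ j ∈ Finset.range q.length,
        (1 + (if (q ++ [b]).getD j false = false then (1 : ℝ) else -1) *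
          prodCoeff μ ((q ++ [b]).take j)) =
        ∏ j ∈ Finset.range q.length,
        (1 + (if q.getD j false = false then (1 : ℝ) else -1) * prodCoeff μ (q.take j)) := by
      refine Finset.prod_congr rfl fun j hj => ?_
      have hj' := Finset.mem_range.mp hj
      rw [List.getD_append _ _ _ _ hj', List.take_append_of_le_length hj'.le]
    have hlast : (q ++ [b]).getD q.length false = b := by simp
    have htake : (q ++ [b]).take q.length = q := by simp
    have hlen : (q ++ [b]).length = q.length + 1 := by simp
    rw [hlen, Finset.prod_range_succ, hprod, hlast, htake, step_aux μ q b hq, pow_succ]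
    conv_lhs => rw [ih hq.le]
    ring
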